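/- arXiv:2507.13452 — 2 statements merged into one kernel-verified Lean document; each statement's English description precedes it below -/
import Mathlib

section
/- Let G be a group scheme over k acting on a scheme X via μ : G × X → X, and let φ : W → X be a morphism of schemes with ψ : Γ_W → G × X the base change of φ along μ. Suppose that for some k-point x of X the orbit map μ_x : G → X is smooth and surjective. Then there exist a surjective étale morphism p : X' → X and a cartesian square with bottom map (1_G × p) : G × X' → G × X, right map ψ, top map W̃ₓ × X' → Γ_W, and left map ψ' : W̃ₓ × X' → G × X' which is the identity on the second factor (i.e. pr₂ ∘ ψ' = pr₂), where W̃ₓ = G ×_{μ_x, X, φ} W is the base change of φ along μ_x. -/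
/-!
Context: `k` is an (algebraically closed) field; all schemes are over `k` and all
morphisms are `k`-morphisms.  A group scheme over `k` is encoded as a scheme `G`
with a structure morphism to `Spec k`, multiplication `m : G ×ₖ G ⟶ G` (defined on
the fiber product over `Spec k`), a unit section and an inversion morphism, with the
group axioms expressed on generalized points (equivalent, by Yoneda, to the usual
commutative diagrams).
-/

open AlgebraicGeometry CategoryTheory CategoryTheory.Limits

noncomputable section

universe u

/-- The base scheme `Spec k` associated to a field `k`. -/
abbrev SpecK (k : Type u) [Field k] : Scheme.{u} := Spec (CommRingCat.of k)

/-- A group scheme over the field `k`. -/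
structure GroupSchemeOver (k : Type u) [Field k] where
  /-- the underlying scheme -/
  G : Scheme.{u}
  /-- the structure morphism to `Spec k` -/
  str : G ⟶ SpecK k
  /-- multiplication `m : G ×ₖ G ⟶ G` -/
  mul : pullback str str ⟶ G
  /-- the unit section -/
  one : SpecK k ⟶ G
  /-- inversion -/
  inv : G ⟶ G
  /-- multiplication is a `k`-morphism -/
  mul_str : mul ≫ str = pullback.fst str str ≫ str
  /-- the unit is a `k`-point -/
  one_str : one ≫ str = 𝟙 (SpecK k)
  /-- inversion is a `k`-morphism -/
  inv_str : inv ≫ str = str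
  /-- associativity, on generalized points -/
  mul_assoc' : ∀ {T : Scheme.{u}} (a b c : T ⟶ G) (hab : a ≫ str = b ≫ str)
      (hbc : b ≫ str = c ≫ str)
      (h₁ : (pullback.lift a b hab ≫ mul) ≫ str = c ≫ str)
      (h₂ : a ≫ str = (pullback.lift b c hbc ≫ mul) ≫ str),
      pullback.lift (pullback.lift a b hab ≫ mul) c h₁ ≫ mul
        = pullback.lift a (pullback.lift b c hbc ≫ mul) h₂ ≫ mul
  /-- left unit law, on generalized points -/
  one_mul' : ∀ {T : Scheme.{u}} (a : T ⟶ G)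
      (h : ((a ≫ str) ≫ one) ≫ str = a ≫ str),
      pullback.lift ((a ≫ str) ≫ one) a h ≫ mul = a
  /-- right unit law, on generalized points -/
  mul_one' : ∀ {T : Scheme.{u}} (a : T ⟶ G)
      (h : a ≫ str = ((a ≫ str) ≫ one) ≫ str),
      pullback.lift a ((a ≫ str) ≫ one) h ≫ mul = a
  /-- left inverse law, on generalized points -/
  inv_mul' : ∀ {T : Scheme.{u}} (a : T ⟶ G)
      (h : (a ≫ inv) ≫ str = a ≫ str),
      pullback.lift (a ≫ inv) a h ≫ mul = (a ≫ str) ≫ one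
  /-- right inverse law, on generalized points -/
  mul_inv' : ∀ {T : Scheme.{u}} (a : T ⟶ G)
      (h : a ≫ str = (a ≫ inv) ≫ str),
      pullback.lift a (a ≫ inv) h ≫ mul = (a ≫ str) ≫ one

/-- An action of the group scheme `Γ` on a scheme `X` over `k`, given by an action
morphism `μ : G ×ₖ X ⟶ X` over `k` satisfying the usual axioms on generalized points. -/
structure ActionSchemeOver (k : Type u) [Field k] (Γ : GroupSchemeOver k) where
  /-- the underlying scheme acted upon -/
  X : Scheme.{u}
  /-- the structure morphism to `Spec k` -/
  strX : X ⟶ SpecK k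
  /-- the action morphism `μ : G ×ₖ X ⟶ X` -/
  act : pullback Γ.str strX ⟶ X
  /-- the action is a `k`-morphism -/
  act_str : act ≫ strX = pullback.fst Γ.str strX ≫ Γ.str
  /-- the unit acts trivially, on generalized points -/
  one_act' : ∀ {T : Scheme.{u}} (x : T ⟶ X)
      (h : ((x ≫ strX) ≫ Γ.one) ≫ Γ.str = x ≫ strX),
      pullback.lift ((x ≫ strX) ≫ Γ.one) x h ≫ act = x
  /-- compatibility of the action with multiplication, on generalized points -/
  mul_act' : ∀ {T : Scheme.{u}} (a b : T ⟶ Γ.G) (x : T ⟶ X)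
      (hab : a ≫ Γ.str = b ≫ Γ.str) (hbx : b ≫ Γ.str = x ≫ strX)
      (h₁ : (pullback.lift a b hab ≫ Γ.mul) ≫ Γ.str = x ≫ strX)
      (h₂ : a ≫ Γ.str = (pullback.lift b x hbx ≫ act) ≫ strX),
      pullback.lift (pullback.lift a b hab ≫ Γ.mul) x h₁ ≫ act
        = pullback.lift a (pullback.lift b x hbx ≫ act) h₂ ≫ act

namespace ActionSchemeOver

variable {k : Type u} [Field k] {Γ : GroupSchemeOver k} (A : ActionSchemeOver k Γ)

/-- The orbit map `μ_x : G ⟶ X`, `g ↦ g·x`, of a `k`-point `x` of `X`. -/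
def orbit (x : SpecK k ⟶ A.X) (hx : x ≫ A.strX = 𝟙 (SpecK k)) : Γ.G ⟶ A.X :=
  pullback.lift (𝟙 Γ.G) (Γ.str ≫ x)
    (by rw [Category.id_comp, Category.assoc, hx, Category.comp_id]) ≫ A.act

@[simp] lemma orbit_comp_strX (x : SpecK k ⟶ A.X) (hx : x ≫ A.strX = 𝟙 (SpecK k)) :
    A.orbit x hx ≫ A.strX = Γ.str := by
  rw [orbit, Category.assoc, A.act_str, ← Category.assoc, pullback.lift_fst,
    Category.id_comp]

end ActionSchemeOver

namespace ActionSchemeOver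

variable {k : Type u} [Field k] {Γ : GroupSchemeOver k} (A : ActionSchemeOver k Γ)

/-- The morphism `1_G × μ_x : G ×ₖ G ⟶ G ×ₖ X`, the identity on the first factor and
the orbit map of the `k`-point `x` on the second factor. -/
def oneTimesOrbit (x : SpecK k ⟶ A.X) (hx : x ≫ A.strX = 𝟙 (SpecK k)) :
    pullback Γ.str Γ.str ⟶ pullback Γ.str A.strX :=
  pullback.lift (pullback.fst Γ.str Γ.str) (pullback.snd Γ.str Γ.str ≫ A.orbit x hx)
    (by rw [Category.assoc, orbit_comp_strX, pullback.condition])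

end ActionSchemeOver

/-- The standard étale pair `(X ^ n - 1, n)`: it adjoins an `n`-th root of unity after
inverting `n`. -/
def rootsOfUnityPair (R : Type*) [CommRing R] (n : ℕ) (hn : n ≠ 0) : StandardEtalePair R where
  f := Polynomial.X ^ n - 1
  monic_f := by
    simpa using Polynomial.monic_X_pow_sub_C (1 : R) hn
  g := (n : Polynomial R)
  cond := by
    obtain ⟨m, rfl⟩ := Nat.exists_eq_succ_of_ne_zero hn
    refine ⟨Polynomial.X, -((m + 1 : ℕ) : Polynomial R), 1, ?_⟩
    simp
    ring

/-- A multivariate polynomial over `R` that does not vanish in an algebraically closed `R`-field `K`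
takes a value with nonzero image in `K` at some point of an étale `R`-algebra over `K`. -/
lemma exists_etale_aeval_ne_zero {R K : Type*} [CommRing R] [Field K] [IsAlgClosed K] [Algebra R K]
    {σ : Type*} [Finite σ] (h : MvPolynomial σ R)
    (hh : MvPolynomial.map (algebraMap R K) h ≠ 0) :
    ∃ (n : ℕ) (hn : n ≠ 0) (ψ : (rootsOfUnityPair R n hn).Ring →ₐ[R] K)
      (a : σ → (rootsOfUnityPair R n hn).Ring), ψ (MvPolynomial.aeval a h) ≠ 0 := by
  classical
  set H := MvPolynomial.map (algebraMap R K) h with hH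
  obtain ⟨n, hdeg, hnK⟩ : ∃ n : ℕ, H.totalDegree < n ∧ (n : K) ≠ 0 := by
    by_cases h0 : ((H.totalDegree + 1 : ℕ) : K) = 0
    · refine ⟨H.totalDegree + 2, by lia, fun h1 ↦ one_ne_zero (α := K) ?_⟩
      push_cast at h0 h1
      linear_combination h1 - h0
    · exact ⟨_, Nat.lt_succ_self _, h0⟩
  have hn : n ≠ 0 := by lia
  have : NeZero n := ⟨hn⟩
  have : NeZero (n : K) := ⟨hnK⟩
  obtain ⟨ζ, hζ⟩ := HasEnoughRootsOfUnity.exists_primitiveRoot K n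
  obtain ⟨α, hα, hαH⟩ : ∃ α : σ → K, (∀ i, α i ∈ Polynomial.nthRootsFinset n (1 : K)) ∧
      MvPolynomial.eval α H ≠ 0 := by
    by_contra! hcon
    refine hh (MvPolynomial.eq_zero_of_eval_zero_at_prod_finset H
      (fun _ ↦ Polynomial.nthRootsFinset n (1 : K)) (fun i ↦ ?_) hcon)
    rw [hζ.card_nthRootsFinset]
    exact (MvPolynomial.degreeOf_le_totalDegree _ _).trans_lt hdeg
  have hpow (i : σ) : ∃ e : ℕ, ζ ^ e = α i := by
    obtain ⟨e, -, he⟩ := hζ.eq_pow_of_pow_eq_one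
      ((Polynomial.mem_nthRootsFinset (Nat.pos_of_ne_zero hn) _).mp (hα i))
    exact ⟨e, he⟩
  choose e he using hpow
  have hmap : (rootsOfUnityPair R n hn).HasMap ζ :=
    ⟨by simp [rootsOfUnityPair, hζ.pow_eq_one], by simp [rootsOfUnityPair, hnK]⟩
  refine ⟨n, hn, (rootsOfUnityPair R n hn).lift ζ hmap,
    fun i ↦ (rootsOfUnityPair R n hn).X ^ e i, ?_⟩
  have : ((rootsOfUnityPair R n hn).lift ζ hmap)
      (MvPolynomial.aeval (fun i ↦ (rootsOfUnityPair R n hn).X ^ e i) h) =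
      MvPolynomial.eval α H := by
    rw [MvPolynomial.comp_aeval_apply, hH, MvPolynomial.eval_map, MvPolynomial.aeval_def]
    congr 1
    ext i
    simp [he]
  rwa [this]

/-- If `R → S` is standard smooth, then every point of `Spec R` in the image of `Spec S` is in
the image of an étale `R`-scheme over which `Spec S → Spec R` has a section. -/
lemma exists_etale_section_of_isStandardSmooth {R S : CommRingCat.{u}} (f : R ⟶ S)
    (hf : f.hom.IsStandardSmooth) (y : Spec S) :
    ∃ (Z : Scheme.{u}) (s : Z ⟶ Spec S), Etale (s ≫ Spec.map f) ∧
      Spec.map f y ∈ Set.range (s ≫ Spec.map f) := by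
  obtain ⟨n, g, hg, hget⟩ := hf.exists_etale_mvPolynomial
  have hgE : Etale (Spec.map (CommRingCat.ofHom g)) := by
    rw [HasRingHomProperty.Spec_iff (P := @Etale)]
    exact hget
  have hopen : IsOpen (Set.range (Spec.map (CommRingCat.ofHom g))) :=
    (Spec.map (CommRingCat.ofHom g)).isOpenMap.isOpen_range
  obtain ⟨_, ⟨_, ⟨h, rfl⟩, rfl⟩, hqh, hsub⟩ :=
    PrimeSpectrum.isBasis_basic_opens.exists_subset_of_mem_open (Set.mem_range_self y) hopen
  obtain ⟨p, hp⟩ : ∃ p : PrimeSpectrum R, p = Spec.map f y := ⟨_, rfl⟩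
  let K := AlgebraicClosure p.asIdeal.ResidueField
  have hker : RingHom.ker (algebraMap R K) = p.asIdeal := by
    rw [IsScalarTower.algebraMap_eq R p.asIdeal.ResidueField K,
      RingHom.ker_comp_of_injective _ (RingHom.injective (algebraMap p.asIdeal.ResidueField K)),
      Ideal.ker_algebraMap_residueField]
  have hh : MvPolynomial.map (algebraMap R K) h ≠ 0 := by
    intro h0
    refine hqh ?_
    have hmem : h ∈ p.asIdeal.map (MvPolynomial.C (σ := Fin n)) := by
      rw [MvPolynomial.mem_map_C_iff]
      intro m
      rw [← hker, RingHom.mem_ker, ← MvPolynomial.coeff_map, h0, MvPolynomial.coeff_zero]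
    refine Ideal.map_le_iff_le_comap.mpr ?_ hmem
    intro r hr
    rw [hp] at hr
    change f.hom r ∈ y.asIdeal at hr
    rw [← hg] at hr
    exact hr
  obtain ⟨N, hN, ψ, a, ha⟩ := exists_etale_aeval_ne_zero h hh
  let R₁ : CommRingCat.{u} := .of (rootsOfUnityPair R N hN).Ring
  let ev : CommRingCat.of (MvPolynomial (Fin n) R) ⟶ R₁ :=
    CommRingCat.ofHom (MvPolynomial.aeval (R := R) a).toRingHom
  let z₁ : Spec R₁ := ⟨RingHom.ker ψ, RingHom.ker_isPrime _⟩
  obtain ⟨y', hy'⟩ : Spec.map ev z₁ ∈ Set.range (Spec.map (CommRingCat.ofHom g)) := hsub ha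
  obtain ⟨z, hz, -⟩ := Scheme.Pullback.exists_preimage_pullback z₁ y' hy'.symm
  have hfac : pullback.snd (Spec.map ev) (Spec.map (CommRingCat.ofHom g)) ≫ Spec.map f =
      pullback.fst (Spec.map ev) (Spec.map (CommRingCat.ofHom g)) ≫
        Spec.map (CommRingCat.ofHom (algebraMap R R₁)) := by
    have h₁ : Spec.map f = Spec.map (CommRingCat.ofHom g) ≫
        Spec.map (CommRingCat.ofHom MvPolynomial.C) := by
      rw [← Spec.map_comp, ← CommRingCat.ofHom_comp, hg, CommRingCat.ofHom_hom]
    have h₂ : CommRingCat.ofHom (algebraMap R R₁) =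
        CommRingCat.ofHom MvPolynomial.C ≫ ev := by
      ext r
      exact (MvPolynomial.aeval_C a r).symm
    rw [h₁, h₂, Spec.map_comp, pullback.condition_assoc]
  have hE : Etale (Spec.map (CommRingCat.ofHom (algebraMap R R₁))) := by
    rw [HasRingHomProperty.Spec_iff (P := @Etale), CommRingCat.hom_ofHom,
      RingHom.etale_algebraMap]
    exact inferInstanceAs (Algebra.Etale R (rootsOfUnityPair R N hN).Ring)
  refine ⟨_, pullback.snd (Spec.map ev) (Spec.map (CommRingCat.ofHom g)), ?_, z, ?_⟩
  · rw [hfac]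
    infer_instance
  · rw [hfac, Scheme.Hom.comp_apply, hz, ← hp]
    refine PrimeSpectrum.ext ?_
    rw [← hker]
    change (RingHom.ker ψ).comap (algebraMap R R₁) = _
    ext r
    simp only [Ideal.mem_comap, RingHom.mem_ker]
    exact Eq.congr_left (ψ.commutes r)

/-- A smooth surjective morphism has a section over some étale surjective morphism. -/
lemma exists_etale_surjective_section {Y X : Scheme.{u}} (f : Y ⟶ X) [Smooth f] [Surjective f] :
    ∃ (X' : Scheme.{u}) (s : X' ⟶ Y), Etale (s ≫ f) ∧ Surjective (s ≫ f) := by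
  have key (x : X) : ∃ (Z : Scheme.{u}) (s : Z ⟶ Y), Etale (s ≫ f) ∧ x ∈ Set.range (s ≫ f) := by
    obtain ⟨y, rfl⟩ := f.surjective x
    obtain ⟨U, hU, V, hV, hyV, e, hst⟩ := Smooth.exists_isStandardSmooth f y
    obtain ⟨y', hy'⟩ : y ∈ Set.range hV.fromSpec := by rwa [hV.range_fromSpec]
    obtain ⟨Z, s, hs, z, hz⟩ := exists_etale_section_of_isStandardSmooth _ hst y'
    have hfac : (s ≫ hV.fromSpec) ≫ f = (s ≫ Spec.map (f.appLE U V e)) ≫ hU.fromSpec := by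
      rw [Category.assoc, Category.assoc, IsAffineOpen.SpecMap_appLE_fromSpec f hU hV e]
    refine ⟨Z, s ≫ hV.fromSpec, ?_, z, ?_⟩
    · rw [hfac]
      infer_instance
    · rw [hfac, Scheme.Hom.comp_apply, hz, ← Scheme.Hom.comp_apply,
        IsAffineOpen.SpecMap_appLE_fromSpec f hU hV e, Scheme.Hom.comp_apply, hy']
  choose Z s hs hx using key
  have hfac : Sigma.desc s ≫ f = Sigma.desc fun x ↦ s x ≫ f := by
    ext1 x
    simp
  refine ⟨∐ Z, Sigma.desc s, ?_, ?_⟩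
  · rw [hfac]
    have : IsZariskiLocalAtSource @Etale.{u} :=
      HasRingHomProperty.instIsZariskiLocalAtSource (P := @Etale.{u}) (Q := RingHom.Etale)
    exact IsZariskiLocalAtSource.sigmaDesc hs
  · rw [hfac]
    exact Surjective.sigmaDesc_of_union_range_eq_univ
      (Set.eq_univ_of_forall fun x ↦ Set.mem_iUnion_of_mem x (hx x))

namespace GroupSchemeOver

variable {k : Type u} [Field k] (Γ : GroupSchemeOver k) {T : Scheme.{u}}

/-- The product of two `T`-valued points of a group scheme. -/
def mulPt (a b : T ⟶ Γ.G) (hab : a ≫ Γ.str = b ≫ Γ.str) : T ⟶ Γ.G :=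
  pullback.lift a b hab ≫ Γ.mul

lemma mulPt_str (a b : T ⟶ Γ.G) (hab : a ≫ Γ.str = b ≫ Γ.str) :
    Γ.mulPt a b hab ≫ Γ.str = b ≫ Γ.str := by
  rw [mulPt, Category.assoc, Γ.mul_str, pullback.lift_fst_assoc, hab]

lemma comp_inv_str (a : T ⟶ Γ.G) : (a ≫ Γ.inv) ≫ Γ.str = a ≫ Γ.str := by
  rw [Category.assoc, Γ.inv_str]

lemma comp_mulPt {T' : Scheme.{u}} (q : T' ⟶ T) (a b : T ⟶ Γ.G)
    (hab : a ≫ Γ.str = b ≫ Γ.str) :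
    q ≫ Γ.mulPt a b hab =
      Γ.mulPt (q ≫ a) (q ≫ b) (by rw [Category.assoc, hab, Category.assoc]) := by
  rw [mulPt, mulPt, ← Category.assoc]
  congr 1
  apply pullback.hom_ext <;>
    simp only [Category.assoc, pullback.lift_fst, pullback.lift_snd]

lemma mulPt_one (a b : T ⟶ Γ.G) (hab : a ≫ Γ.str = b ≫ Γ.str)
    (hb : b = (a ≫ Γ.str) ≫ Γ.one) : Γ.mulPt a b hab = a := by
  subst hb
  exact Γ.mul_one' a hab

lemma mulPt_mulPt_inv (a b : T ⟶ Γ.G) (hab : a ≫ Γ.str = b ≫ Γ.str) :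
    Γ.mulPt (Γ.mulPt a b hab) (b ≫ Γ.inv)
      (by rw [mulPt_str, comp_inv_str]) = a := by
  have hinv : b ≫ Γ.str = (b ≫ Γ.inv) ≫ Γ.str := (Γ.comp_inv_str b).symm
  have h := Γ.mul_assoc' a b (b ≫ Γ.inv) hab hinv ((Γ.mulPt_str _ _ _).trans hinv)
    ((hab.trans hinv).trans (Γ.mulPt_str _ _ hinv).symm)
  refine h.trans (Γ.mulPt_one a _ _ ?_)
  rw [hab]
  exact Γ.mul_inv' b hinv

lemma mulPt_inv_mulPt (a b : T ⟶ Γ.G) (hab : a ≫ Γ.str = b ≫ Γ.str) :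
    Γ.mulPt (Γ.mulPt a (b ≫ Γ.inv) (by rw [comp_inv_str, hab])) b
      (by rw [mulPt_str, comp_inv_str]) = a := by
  have hinv : (b ≫ Γ.inv) ≫ Γ.str = b ≫ Γ.str := Γ.comp_inv_str b
  have h := Γ.mul_assoc' a (b ≫ Γ.inv) b (hab.trans hinv.symm) hinv
    ((Γ.mulPt_str _ _ _).trans hinv) (hab.trans (Γ.mulPt_str _ _ hinv).symm)
  refine h.trans (Γ.mulPt_one a _ _ ?_)
  rw [hab]
  exact Γ.inv_mul' b hinv

end GroupSchemeOver

namespace ActionSchemeOver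

variable {k : Type u} [Field k] {Γ : GroupSchemeOver k} (A : ActionSchemeOver k Γ)
  (x : SpecK k ⟶ A.X) (hx : x ≫ A.strX = 𝟙 (SpecK k)) {T : Scheme.{u}}

lemma comp_orbit (b : T ⟶ Γ.G) :
    b ≫ A.orbit x hx = pullback.lift b ((b ≫ Γ.str) ≫ x)
      (by rw [Category.assoc, hx, Category.comp_id]) ≫ A.act := by
  rw [orbit, ← Category.assoc]
  congr 1
  apply pullback.hom_ext <;>
    simp only [Category.assoc, pullback.lift_fst, pullback.lift_snd, Category.comp_id]

lemma mulPt_orbit (a b : T ⟶ Γ.G) (hab : a ≫ Γ.str = b ≫ Γ.str) :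
    Γ.mulPt a b hab ≫ A.orbit x hx =
      pullback.lift a (b ≫ A.orbit x hx)
        (by rw [Category.assoc, orbit_comp_strX, hab]) ≫ A.act := by
  have hbx : b ≫ Γ.str = ((b ≫ Γ.str) ≫ x) ≫ A.strX := by
    rw [Category.assoc, hx, Category.comp_id]
  have hb := A.comp_orbit x hx b
  have h := A.mul_act' a b ((b ≫ Γ.str) ≫ x) hab hbx ((Γ.mulPt_str a b hab).trans hbx)
    (by rw [← hb, Category.assoc, orbit_comp_strX, hab])
  rw [comp_orbit]
  simp only [Γ.mulPt_str a b hab, hb]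
  exact h

/-- If `p = s ≫ μ_x`, the correspondence `Γ_W` pulled back along `1_G × p` is the product of
`W̃ₓ` and `X'`, the isomorphism being `(g, x') ↦ (g s(x'), x')` on the base. -/
lemma exists_isPullback_of_section {X' W : Scheme.{u}} (φ : W ⟶ A.X) (p : X' ⟶ A.X)
    (s : X' ⟶ Γ.G) (hp : s ≫ A.orbit x hx = p) (q : X' ⟶ SpecK k) (hq : p ≫ A.strX = q)
    (v : pullback (A.orbit x hx) φ ⟶ SpecK k)
    (hv : pullback.fst (A.orbit x hx) φ ≫ Γ.str = v)
    (b : pullback Γ.str q ⟶ pullback Γ.str A.strX)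
    (hb₁ : b ≫ pullback.fst _ _ = pullback.fst _ _)
    (hb₂ : b ≫ pullback.snd _ _ = pullback.snd _ _ ≫ p) :
    ∃ (ψ' : pullback v q ⟶ pullback Γ.str q) (t : pullback v q ⟶ pullback A.act φ),
      ψ' ≫ pullback.snd _ _ = pullback.snd _ _ ∧
      IsPullback t ψ' (pullback.fst A.act φ) b := by
  have hstr : s ≫ Γ.str = q := by
    rw [← hq, ← hp, Category.assoc, A.orbit_comp_strX]
  obtain ⟨γ, hγ⟩ : ∃ γ : pullback v q ⟶ Γ.G,
      pullback.fst v q ≫ pullback.fst (A.orbit x hx) φ = γ := ⟨_, rfl⟩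
  obtain ⟨w, hw⟩ : ∃ w : pullback v q ⟶ W,
      pullback.fst v q ≫ pullback.snd (A.orbit x hx) φ = w := ⟨_, rfl⟩
  obtain ⟨x', hx'⟩ : ∃ x' : pullback v q ⟶ X', pullback.snd v q = x' := ⟨_, rfl⟩
  have hγx : γ ≫ Γ.str = (x' ≫ s) ≫ Γ.str := by
    rw [← hγ, Category.assoc, hv, Category.assoc, hstr, ← hx', pullback.condition]
  have hγw : γ ≫ A.orbit x hx = w ≫ φ := by
    rw [← hγ, ← hw, Category.assoc, Category.assoc, pullback.condition]
  obtain ⟨g, hgdef⟩ : ∃ g, Γ.mulPt γ ((x' ≫ s) ≫ Γ.inv) (by rw [Γ.comp_inv_str, hγx]) = g :=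
    ⟨_, rfl⟩
  have hg : g ≫ Γ.str = (x' ≫ s) ≫ Γ.str := by
    rw [← hgdef, Γ.mulPt_str, Γ.comp_inv_str]
  have hgx' : g ≫ Γ.str = x' ≫ q := by rw [hg, Category.assoc, hstr]
  have hgγ : Γ.mulPt g (x' ≫ s) hg = γ := by
    subst hgdef
    exact Γ.mulPt_inv_mulPt γ (x' ≫ s) hγx
  obtain ⟨ψ', hψ₁, hψ₂⟩ : ∃ ψ' : pullback v q ⟶ pullback Γ.str q,
      ψ' ≫ pullback.fst _ _ = g ∧ ψ' ≫ pullback.snd _ _ = x' :=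
    ⟨pullback.lift g x' hgx', pullback.lift_fst _ _ _, pullback.lift_snd _ _ _⟩
  have hact {T : Scheme.{u}} (r : T ⟶ pullback Γ.str q) (c : T ⟶ Γ.G)
      (hr : (r ≫ pullback.fst _ _) ≫ Γ.str = ((r ≫ pullback.snd _ _) ≫ s) ≫ Γ.str)
      (hc : Γ.mulPt (r ≫ pullback.fst _ _) ((r ≫ pullback.snd _ _) ≫ s) hr = c) :
      (r ≫ b) ≫ A.act = c ≫ A.orbit x hx := by
    rw [← hc, A.mulPt_orbit]
    congr 1
    apply pullback.hom_ext
    · rw [pullback.lift_fst, Category.assoc, hb₁]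
    · rw [pullback.lift_snd, Category.assoc, hb₂, Category.assoc, Category.assoc, hp]
  obtain ⟨t, ht₁, ht₂⟩ : ∃ t : pullback v q ⟶ pullback A.act φ,
      t ≫ pullback.fst _ _ = ψ' ≫ b ∧ t ≫ pullback.snd _ _ = w := by
    refine ⟨pullback.lift (ψ' ≫ b) w ?_, pullback.lift_fst _ _ _, pullback.lift_snd _ _ _⟩
    rw [hact ψ' γ (by rw [hψ₁, hψ₂, hg]) (by simp only [hψ₁, hψ₂, hgγ]), hγw]
  have key {T : Scheme.{u}} (a : T ⟶ pullback A.act φ) (r : T ⟶ pullback Γ.str q)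
      (har : a ≫ pullback.fst _ _ = r ≫ b) :
      ∃ l : T ⟶ pullback v q, l ≫ t = a ∧ l ≫ ψ' = r ∧
        ∀ m : T ⟶ pullback v q, m ≫ t = a → m ≫ ψ' = r → m = l := by
    obtain ⟨gT, hgT⟩ : ∃ gT, r ≫ pullback.fst _ _ = gT := ⟨_, rfl⟩
    obtain ⟨xT, hxT⟩ : ∃ xT, r ≫ pullback.snd _ _ = xT := ⟨_, rfl⟩
    obtain ⟨wT, hwT⟩ : ∃ wT, a ≫ pullback.snd _ _ = wT := ⟨_, rfl⟩
    have hgx : gT ≫ Γ.str = (xT ≫ s) ≫ Γ.str := by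
      rw [← hgT, ← hxT, Category.assoc, Category.assoc, Category.assoc, hstr, pullback.condition]
    obtain ⟨γT, hγT⟩ : ∃ γT, Γ.mulPt gT (xT ≫ s) hgx = γT := ⟨_, rfl⟩
    have hγw' : γT ≫ A.orbit x hx = wT ≫ φ := by
      rw [← hact r γT (by rw [hgT, hxT, hgx]) (by simp only [hgT, hxT, hγT]), ← har,
        Category.assoc, pullback.condition, ← Category.assoc, hwT]
    have hlv : pullback.lift γT wT hγw' ≫ v = xT ≫ q := by
      rw [← hv, pullback.lift_fst_assoc, ← hγT, Γ.mulPt_str, Category.assoc, hstr]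
    obtain ⟨l, hlγ, hlw, hlx⟩ : ∃ l : T ⟶ pullback v q, l ≫ γ = γT ∧ l ≫ w = wT ∧ l ≫ x' = xT := by
      refine ⟨pullback.lift (pullback.lift γT wT hγw') xT hlv, ?_, ?_, ?_⟩
      · rw [← hγ, pullback.lift_fst_assoc, pullback.lift_fst]
      · rw [← hw, pullback.lift_fst_assoc, pullback.lift_snd]
      · rw [← hx', pullback.lift_snd]
    have hlg : l ≫ g = gT := by
      subst hγT
      rw [← hgdef, Γ.comp_mulPt]
      refine Eq.trans ?_ (Γ.mulPt_mulPt_inv gT (xT ≫ s) hgx)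
      simp only [hlγ, reassoc_of% hlx, Category.assoc]
    have hlψ : l ≫ ψ' = r := by
      apply pullback.hom_ext
      · rw [Category.assoc, hψ₁, hlg, hgT]
      · rw [Category.assoc, hψ₂, hlx, hxT]
    refine ⟨l, ?_, hlψ, fun m hm₁ hm₂ ↦ ?_⟩
    · apply pullback.hom_ext
      · rw [Category.assoc, ht₁, reassoc_of% hlψ, har]
      · rw [Category.assoc, ht₂, hlw, hwT]
    have hmg : m ≫ g = gT := by rw [← hψ₁, reassoc_of% hm₂, hgT]
    have hmx : m ≫ x' = xT := by rw [← hψ₂, reassoc_of% hm₂, hxT]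
    have hmw : m ≫ w = wT := by rw [← ht₂, reassoc_of% hm₁, hwT]
    have hmγ : m ≫ γ = γT := by
      rw [← hgγ, Γ.comp_mulPt, ← hγT]
      simp only [hmg, reassoc_of% hmx]
    apply pullback.hom_ext
    · apply pullback.hom_ext
      · rw [Category.assoc, Category.assoc, hγ, hmγ, hlγ]
      · rw [Category.assoc, Category.assoc, hw, hmw, hlw]
    · rw [hx', hmx, hlx]
  refine ⟨ψ', t, hψ₂.trans hx'.symm, ⟨ht₁⟩, ⟨PullbackCone.isLimitAux' _ fun c ↦ ?_⟩⟩
  choose l hl₁ hl₂ hl₃ using key c.fst c.snd c.condition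
  exact ⟨l, hl₁, hl₂, fun h₁ h₂ ↦ hl₃ _ h₁ h₂⟩

end ActionSchemeOver

/-- **étale local triviality of the correspondence.** Let `G` be a group
scheme over `k` acting on `X` via `μ`, let `φ : W ⟶ X` be a morphism of schemes over
`k` with `ψ : Γ_W = (G ×ₖ X) ×_{μ, X, φ} W ⟶ G ×ₖ X` the base change of `φ` along
`μ`, and suppose that for some `k`-point `x` of `X` the orbit map `μ_x : G ⟶ X` is
smooth and surjective.  Then there exist a surjective étale morphism `p : X' ⟶ X` and
a cartesian square with bottom map `1_G × p : G ×ₖ X' ⟶ G ×ₖ X`, right map `ψ`, top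
map `W̃ₓ ×ₖ X' ⟶ Γ_W` and left map `ψ' : W̃ₓ ×ₖ X' ⟶ G ×ₖ X'` which is the
identity on the second factor, where `W̃ₓ = G ×_{μ_x, X, φ} W`. -/
theorem etale_local_triviality_correspondence (k : Type u) [Field k]
    (Γ : GroupSchemeOver k) (A : ActionSchemeOver k Γ)
    (W : Scheme.{u}) (strW : W ⟶ SpecK k) (φ : W ⟶ A.X) (hφ : φ ≫ A.strX = strW)
    (x : SpecK k ⟶ A.X) (hx : x ≫ A.strX = 𝟙 (SpecK k))
    (hsm : IsSmooth (A.orbit x hx)) (hsurj : Surjective (A.orbit x hx)) :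
    ∃ (X' : Scheme.{u}) (p : X' ⟶ A.X), IsEtale p ∧ Surjective p ∧
      ∃ (ψ' : pullback (pullback.fst (A.orbit x hx) φ ≫ Γ.str) (p ≫ A.strX) ⟶
            pullback Γ.str (p ≫ A.strX))
        (t : pullback (pullback.fst (A.orbit x hx) φ ≫ Γ.str) (p ≫ A.strX) ⟶
            pullback A.act φ),
        ψ' ≫ pullback.snd Γ.str (p ≫ A.strX)
            = pullback.snd (pullback.fst (A.orbit x hx) φ ≫ Γ.str) (p ≫ A.strX) ∧
        IsPullback t ψ' (pullback.fst A.act φ)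
          (pullback.lift (pullback.fst Γ.str (p ≫ A.strX))
            (pullback.snd Γ.str (p ≫ A.strX) ≫ p)
            (by rw [pullback.condition, Category.assoc])) := by
  have : Smooth (A.orbit x hx) := hsm
  obtain ⟨X', s, hE, hS⟩ := exists_etale_surjective_section (A.orbit x hx)
  exact ⟨X', s ≫ A.orbit x hx, hE, hS, A.exists_isPullback_of_section x hx φ _ s rfl _ rfl _ rfl _
    (pullback.lift_fst _ _ _) (pullback.lift_snd _ _ _)⟩
end
end

section
/- Let G be a group scheme over k acting on a scheme X via μ : G × X → X, and let φ : W → X be a morphism of schemes where W is smooth over k. Suppose that for some k-point x of X the orbit map μ_x : G → X is smooth and surjective. Then the morphism π_W : Γ_W → X is smooth, where Γ_W = (G × X) ×_{μ, X, φ} W, ψ : Γ_W → G × X is the projection, and π_W is the composite of ψ with the projection G × X → X. -/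
/-!
Context: `k` is an (algebraically closed) field; all schemes are over `k` and all
morphisms are `k`-morphisms.  A group scheme over `k` is encoded as a scheme `G`
with a structure morphism to `Spec k`, multiplication `m : G ×ₖ G ⟶ G` (defined on
the fiber product over `Spec k`), a unit section and an inversion morphism, with the
group axioms expressed on generalized points (equivalent, by Yoneda, to the usual
commutative diagrams).
-/

open AlgebraicGeometry CategoryTheory CategoryTheory.Limits

noncomputable section

universe u

/-- Fppf descent for morphism properties whose ring homomorphism counterparts codescend along
faithfully flat ring homomorphisms. -/
lemma AlgebraicGeometry.HasRingHomProperty.descendsAlong_flat_of_locallyOfFinitePresentation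
    {P : MorphismProperty Scheme.{u}} [P.IsStableUnderBaseChange]
    {Q : ∀ {R S : Type u} [CommRing R] [CommRing S], (R →+* S) → Prop}
    [HasRingHomProperty P Q] (h : RingHom.CodescendsAlong Q RingHom.FaithfullyFlat) :
    P.DescendsAlong (@Surjective ⊓ @Flat ⊓ @LocallyOfFinitePresentation) :=
  have := HasRingHomProperty.descendsAlong_flat (P := P) h
  inferInstance

namespace GroupSchemeOver

variable {k : Type u} [Field k] (Γ : GroupSchemeOver k) {T : Scheme.{u}}

lemma mul_inv_mul_cancel (a b : T ⟶ Γ.G) (h : a ≫ Γ.str = (b ≫ Γ.inv) ≫ Γ.str)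
    (h' : (pullback.lift a (b ≫ Γ.inv) h ≫ Γ.mul) ≫ Γ.str = b ≫ Γ.str) :
    pullback.lift (pullback.lift a (b ≫ Γ.inv) h ≫ Γ.mul) b h' ≫ Γ.mul = a := by
  have hinv : (b ≫ Γ.inv) ≫ Γ.str = b ≫ Γ.str := by rw [Category.assoc, Γ.inv_str]
  have hone : a ≫ Γ.str = ((a ≫ Γ.str) ≫ Γ.one) ≫ Γ.str := by
    rw [Category.assoc, Γ.one_str, Category.comp_id]
  have hunit : pullback.lift (b ≫ Γ.inv) b hinv ≫ Γ.mul = (a ≫ Γ.str) ≫ Γ.one := by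
    rw [Γ.inv_mul', h, hinv]
  rw [Γ.mul_assoc' a (b ≫ Γ.inv) b h hinv h' (by rw [hunit]; exact hone)]
  simp only [hunit]
  exact Γ.mul_one' a hone

lemma mul_mul_inv_cancel (a b : T ⟶ Γ.G) (h : a ≫ Γ.str = b ≫ Γ.str)
    (h' : (pullback.lift a b h ≫ Γ.mul) ≫ Γ.str = (b ≫ Γ.inv) ≫ Γ.str) :
    pullback.lift (pullback.lift a b h ≫ Γ.mul) (b ≫ Γ.inv) h' ≫ Γ.mul = a := by
  have hinv : b ≫ Γ.str = (b ≫ Γ.inv) ≫ Γ.str := by rw [Category.assoc, Γ.inv_str]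
  have hone : a ≫ Γ.str = ((a ≫ Γ.str) ≫ Γ.one) ≫ Γ.str := by
    rw [Category.assoc, Γ.one_str, Category.comp_id]
  have hunit : pullback.lift b (b ≫ Γ.inv) hinv ≫ Γ.mul = (a ≫ Γ.str) ≫ Γ.one := by
    rw [Γ.mul_inv', h]
  rw [Γ.mul_assoc' a b (b ≫ Γ.inv) h hinv h' (by rw [hunit]; exact hone)]
  simp only [hunit]
  exact Γ.mul_one' a hone

lemma eq_of_mul_right_eq (a a' b : T ⟶ Γ.G) (h : a ≫ Γ.str = b ≫ Γ.str)
    (h' : a' ≫ Γ.str = b ≫ Γ.str)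
    (heq : pullback.lift a b h ≫ Γ.mul = pullback.lift a' b h' ≫ Γ.mul) : a = a' := by
  have key (c : T ⟶ Γ.G) (hc : c ≫ Γ.str = b ≫ Γ.str) :
      (pullback.lift c b hc ≫ Γ.mul) ≫ Γ.str = (b ≫ Γ.inv) ≫ Γ.str := by
    rw [Category.assoc, Γ.mul_str, pullback.lift_fst_assoc, Category.assoc, Γ.inv_str, hc]
  rw [← Γ.mul_mul_inv_cancel a b h (key a h), ← Γ.mul_mul_inv_cancel a' b h' (key a' h')]
  simp only [heq]

/-- The shear map `(g, h) ↦ (gh, h)` is an isomorphism. -/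
lemma isPullback_mul_snd :
    IsPullback Γ.mul (pullback.snd Γ.str Γ.str) Γ.str Γ.str := by
  have hinv {T : Scheme.{u}} (a b : T ⟶ Γ.G) (h : a ≫ Γ.str = b ≫ Γ.str) :
      a ≫ Γ.str = (b ≫ Γ.inv) ≫ Γ.str := by rw [Category.assoc, Γ.inv_str, h]
  have hdiv {T : Scheme.{u}} (a b : T ⟶ Γ.G) (h : a ≫ Γ.str = b ≫ Γ.str) :
      (pullback.lift a (b ≫ Γ.inv) (hinv a b h) ≫ Γ.mul) ≫ Γ.str = b ≫ Γ.str := by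
    rw [Category.assoc, Γ.mul_str, pullback.lift_fst_assoc, h]
  refine ⟨⟨by rw [Γ.mul_str, pullback.condition]⟩, ⟨PullbackCone.IsLimit.mk _
    (fun s ↦ pullback.lift _ s.snd (hdiv s.fst s.snd s.condition))
    (fun s ↦ Γ.mul_inv_mul_cancel _ _ _ _) (fun s ↦ pullback.lift_snd _ _ _) ?_⟩⟩
  intro s m hm₁ hm₂
  have hm : m = pullback.lift (m ≫ pullback.fst _ _) s.snd
      (by rw [← hm₂, Category.assoc, Category.assoc, pullback.condition]) := by
    apply pullback.hom_ext
    · rw [pullback.lift_fst]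
    · rw [pullback.lift_snd, hm₂]
  refine pullback.hom_ext ?_ (by rw [hm₂, pullback.lift_snd])
  rw [pullback.lift_fst]
  refine Γ.eq_of_mul_right_eq _ _ s.snd ?_ (hdiv _ _ s.condition) ?_
  · rw [← hm₂, Category.assoc, Category.assoc, pullback.condition]
  · rw [← hm, hm₁, Γ.mul_inv_mul_cancel]

end GroupSchemeOver

namespace ActionSchemeOver

variable {k : Type u} [Field k] {Γ : GroupSchemeOver k} (A : ActionSchemeOver k Γ)
  (x : SpecK k ⟶ A.X) (hx : x ≫ A.strX = 𝟙 (SpecK k))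

/-- The morphism `G ×ₖ G ⟶ G ×ₖ X`, `(g, h) ↦ (g, h·x)`. -/
def prodOrbit : pullback Γ.str Γ.str ⟶ pullback Γ.str A.strX :=
  pullback.lift (pullback.fst _ _) (pullback.snd _ _ ≫ A.orbit x hx)
    (by rw [Category.assoc, orbit_comp_strX, pullback.condition])

lemma isPullback_prodOrbit :
    IsPullback (A.prodOrbit x hx) (pullback.snd Γ.str Γ.str) (pullback.snd Γ.str A.strX)
      (A.orbit x hx) := by
  refine IsPullback.of_right (h₁₂ := pullback.fst Γ.str A.strX) (v₁₃ := Γ.str) (h₂₂ := A.strX) ?_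
    (pullback.lift_snd _ _ _) (IsPullback.of_hasPullback Γ.str A.strX)
  rw [prodOrbit, pullback.lift_fst, orbit_comp_strX]
  exact IsPullback.of_hasPullback Γ.str Γ.str

lemma comp_orbit_s7 {T : Scheme.{u}} (a : T ⟶ Γ.G) (h : a ≫ Γ.str = (a ≫ Γ.str ≫ x) ≫ A.strX) :
    a ≫ A.orbit x hx = pullback.lift a (a ≫ Γ.str ≫ x) h ≫ A.act := by
  rw [orbit, ← Category.assoc]
  congr 1
  apply pullback.hom_ext
  · rw [Category.assoc, pullback.lift_fst, pullback.lift_fst, Category.comp_id]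
  · rw [Category.assoc, pullback.lift_snd, pullback.lift_snd]

lemma mul_comp_orbit :
    Γ.mul ≫ A.orbit x hx = A.prodOrbit x hx ≫ A.act := by
  have hpt {T : Scheme.{u}} (a : T ⟶ Γ.G) : a ≫ Γ.str = (a ≫ Γ.str ≫ x) ≫ A.strX := by
    rw [Category.assoc, Category.assoc, hx, Category.comp_id]
  have hmul : pullback.lift (pullback.fst Γ.str Γ.str) (pullback.snd Γ.str Γ.str)
      pullback.condition ≫ Γ.mul = Γ.mul := by
    rw [pullback.lift_fst_snd, Category.id_comp]
  have hstr : Γ.mul ≫ Γ.str ≫ x = pullback.snd Γ.str Γ.str ≫ Γ.str ≫ x := by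
    rw [← Category.assoc, Γ.mul_str, pullback.condition, Category.assoc]
  have hact := A.mul_act' (pullback.fst Γ.str Γ.str) (pullback.snd Γ.str Γ.str)
    (pullback.snd Γ.str Γ.str ≫ Γ.str ≫ x) pullback.condition (hpt _)
    (by rw [hmul, ← hstr]; exact hpt _)
    (by rw [← A.comp_orbit_s7 x hx, Category.assoc, orbit_comp_strX, pullback.condition])
  rw [A.comp_orbit_s7 x hx _ (hpt _)]
  simp only [hmul, ← A.comp_orbit_s7 x hx] at hact
  simp only [hstr]
  exact hact

end ActionSchemeOver

/-- Let `G` be a group scheme over `k` acting on `X` via `μ`, and let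
`φ : W ⟶ X` be a morphism of schemes over `k` with `W` smooth over `k`.  Suppose that
for some `k`-point `x` of `X` the orbit map `μ_x : G ⟶ X` is smooth and surjective.
Then the morphism `π_W : Γ_W ⟶ X` is smooth, where `Γ_W = (G ×ₖ X) ×_{μ, X, φ} W`,
`ψ : Γ_W ⟶ G ×ₖ X` is the projection and `π_W = pr_X ∘ ψ`. -/
theorem piW_isSmooth (k : Type u) [Field k]
    (Γ : GroupSchemeOver k) (A : ActionSchemeOver k Γ)
    (W : Scheme.{u}) (strW : W ⟶ SpecK k) (φ : W ⟶ A.X) (hφ : φ ≫ A.strX = strW)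
    (hW : IsSmooth strW)
    (x : SpecK k ⟶ A.X) (hx : x ≫ A.strX = 𝟙 (SpecK k))
    (hsm : IsSmooth (A.orbit x hx)) (hsurj : Surjective (A.orbit x hx)) :
    IsSmooth (pullback.fst A.act φ ≫ pullback.snd Γ.str A.strX) := by
  subst hφ
  let o := A.orbit x hx
  have hZ : Smooth (pullback.fst o φ ≫ Γ.str) := by
    have : pullback.fst o φ ≫ Γ.str = pullback.snd o φ ≫ φ ≫ A.strX := by
      rw [← pullback.condition_assoc, A.orbit_comp_strX]
    rw [this]
    have : Smooth o := hsm
    have : Smooth (φ ≫ A.strX) := hW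
    infer_instance
  have hP := IsPullback.of_hasPullback Γ.mul (pullback.fst o φ)
  have hsmooth : Smooth (pullback.fst Γ.mul (pullback.fst o φ) ≫ pullback.snd Γ.str Γ.str) :=
    MorphismProperty.of_isPullback (P := @Smooth)
      (hP.flip.paste_vert Γ.isPullback_mul_snd) hZ
  have hQ := hP.flip.paste_horiz (IsPullback.of_hasPullback o φ).flip
  rw [A.mul_comp_orbit x hx] at hQ
  have hR := (IsPullback.of_right' hQ (IsPullback.of_hasPullback A.act φ).flip).paste_vert
    (A.isPullback_prodOrbit x hx)
  have := HasRingHomProperty.descendsAlong_flat_of_locallyOfFinitePresentation (P := @Smooth.{u})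
    RingHom.Smooth.codescendsAlong_faithfullyFlat
  exact MorphismProperty.of_isPullback_of_descendsAlong (P := @Smooth)
    (Q := @Surjective ⊓ @Flat ⊓ @LocallyOfFinitePresentation) hR.flip
    ⟨⟨hsurj, have : Smooth o := hsm; inferInstanceAs (Flat o)⟩,
      have : Smooth o := hsm; inferInstanceAs (LocallyOfFinitePresentation o)⟩ hsmooth
end
end
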